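/- arXiv:1412.5714 — 5 statements merged into one kernel-verified Lean document; each statement's English description precedes it below -/
import Mathlib

section
/- Let R be a commutative ring. Then R is J-stable if and only if the following holds: whenever a₁, a₂, a₃ ∈ R satisfy a₁R + a₂R + a₃R = R and a₁ ∉ J(R), there exists b ∈ R such that a₁R + (a₂ + a₃b)R = R. -/
/-- A commutative ring has stable range 1 if whenever `aR + bR = R`,
there exists `y` such that `a + b * y` is a unit. -/
def StableRange1 (R : Type*) [CommRing R] : Prop :=
  ∀ a b : R, Ideal.span {a} ⊔ Ideal.span {b} = ⊤ → ∃ y : R, IsUnit (a + b * y)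

/-- A commutative ring is J-stable if `R/aR` has stable range 1 for every
`a` not in the Jacobson radical. -/
def JStable (R : Type*) [CommRing R] : Prop :=
  ∀ a : R, a ∉ Ideal.jacobson (⊥ : Ideal R) → StableRange1 (R ⧸ Ideal.span {a})

theorem Ideal.map_quotientMk_eq_top_iff {R : Type*} [CommRing R] (I J : Ideal R) :
    J.map (Ideal.Quotient.mk I) = ⊤ ↔ I ⊔ J = ⊤ := by
  rw [← Ideal.comap_map_quotientMk, Ideal.comap_eq_top_iff]

theorem stableRange1_quotient_iff {R : Type*} [CommRing R] (I : Ideal R) :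
    StableRange1 (R ⧸ I) ↔
      ∀ x y : R, I ⊔ Ideal.span {x} ⊔ Ideal.span {y} = ⊤ →
        ∃ b : R, I ⊔ Ideal.span {x + y * b} = ⊤ := by
  have mk_surjective := Ideal.Quotient.mk_surjective (I := I)
  have span_mk (x : R) : Ideal.span {Ideal.Quotient.mk I x} =
      (Ideal.span {x}).map (Ideal.Quotient.mk I) := by
    rw [Ideal.map_span, Set.image_singleton]
  simp only [StableRange1, mk_surjective.forall, mk_surjective.exists, ← map_mul, ← map_add,
    ← Ideal.span_singleton_eq_top, span_mk, ← Ideal.map_sup,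
    Ideal.map_quotientMk_eq_top_iff, sup_assoc]

theorem jstable_iff_three_term (R : Type*) [CommRing R] :
    JStable R ↔
      ∀ a₁ a₂ a₃ : R,
        Ideal.span {a₁} ⊔ Ideal.span {a₂} ⊔ Ideal.span {a₃} = ⊤ →
        a₁ ∉ Ideal.jacobson (⊥ : Ideal R) →
        ∃ b : R, Ideal.span {a₁} ⊔ Ideal.span {a₂ + a₃ * b} = ⊤ := by
  simp only [JStable, stableRange1_quotient_iff]
  exact ⟨fun h a x y hxy ha => h a ha x y hxy, fun h a ha x y hxy => h a x y hxy ha⟩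
end

section
/- Let R be a commutative ring. Then R is J-stable if and only if the following holds: for every three elements a, b, c ∈ R such that a ∉ J(R) and bR + cR = R, there exists y ∈ R such that aR + (b + cy)R = R. -/
theorem Ideal.span_singleton_sup_eq_top_iff_isCoprime {R : Type*} [CommRing R] (a b : R) :
    Ideal.span {a} ⊔ Ideal.span {b} = ⊤ ↔ IsCoprime a b := by
  rw [← Ideal.isCoprime_iff_sup_eq, Ideal.isCoprime_span_singleton_iff]

theorem Ideal.Quotient.isUnit_mk_span_singleton_iff {R : Type*} [CommRing R] (a b : R) :
    IsUnit (Ideal.Quotient.mk (Ideal.span {a}) b) ↔ IsCoprime a b := by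
  rw [isUnit_iff_exists_inv]
  constructor
  · rintro ⟨v, hv⟩
    obtain ⟨v, rfl⟩ := Ideal.Quotient.mk_surjective v
    rw [← map_mul, ← map_one (Ideal.Quotient.mk (Ideal.span {a})), Ideal.Quotient.eq,
      Ideal.mem_span_singleton] at hv
    obtain ⟨d, hd⟩ := hv
    exact ⟨-d, v, by linear_combination hd⟩
  · rintro ⟨u, v, h⟩
    refine ⟨Ideal.Quotient.mk _ v, ?_⟩
    rw [← map_mul, ← map_one (Ideal.Quotient.mk (Ideal.span {a})), Ideal.Quotient.eq,
      Ideal.mem_span_singleton]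
    exact ⟨-u, by linear_combination h⟩

theorem jstable_iff_comax (R : Type*) [CommRing R] :
    JStable R ↔
      ∀ a b c : R, a ∉ Ideal.jacobson (⊥ : Ideal R) →
        Ideal.span {b} ⊔ Ideal.span {c} = ⊤ →
        ∃ y : R, Ideal.span {a} ⊔ Ideal.span {b + c * y} = ⊤ := by
  simp only [JStable, StableRange1, Ideal.span_singleton_sup_eq_top_iff_isCoprime]
  constructor
  · intro h a b c ha hbc
    obtain ⟨y, hy⟩ := h a ha _ _ (hbc.map (Ideal.Quotient.mk (Ideal.span {a})))
    obtain ⟨y, rfl⟩ := Ideal.Quotient.mk_surjective y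
    rw [← map_mul, ← map_add, Ideal.Quotient.isUnit_mk_span_singleton_iff] at hy
    exact ⟨y, hy⟩
  · intro h a ha b c hbc
    obtain ⟨b, rfl⟩ := Ideal.Quotient.mk_surjective b
    obtain ⟨c, rfl⟩ := Ideal.Quotient.mk_surjective c
    obtain ⟨u, v, huv⟩ := hbc
    obtain ⟨u, rfl⟩ := Ideal.Quotient.mk_surjective u
    obtain ⟨v, rfl⟩ := Ideal.Quotient.mk_surjective v
    rw [← map_mul, ← map_mul, ← map_add, ← map_one (Ideal.Quotient.mk (Ideal.span {a})),
      Ideal.Quotient.eq, Ideal.mem_span_singleton] at huv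
    obtain ⟨d, hd⟩ := huv
    obtain ⟨t, p, q, hpq⟩ :=
      h a b (c * v - a * d) ha ⟨u, 1, by linear_combination hd⟩
    refine ⟨Ideal.Quotient.mk _ (v * t), ?_⟩
    rw [← map_mul, ← map_add, Ideal.Quotient.isUnit_mk_span_singleton_iff]
    exact ⟨p - q * d * t, q, by linear_combination hpq⟩
end

section
/- Let R be a commutative ring and let M be an R-module. Then R is J-stable if and only if the trivial extension T(R, M) (the ring of pairs (r, m) with componentwise addition and multiplication (r₁, m₁)(r₂, m₂) = (r₁r₂, r₁m₂ + r₂m₁)) is J-stable. -/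
theorem isUnit_quotient_span_singleton_mk_iff {R : Type*} [CommRing R] (a p : R) :
    IsUnit (Ideal.Quotient.mk (Ideal.span {a}) p) ↔ ∃ u v : R, IsUnit (p * u + a * v) := by
  constructor
  · intro h
    obtain ⟨c, hc⟩ := isUnit_iff_exists_inv.mp h
    obtain ⟨u, rfl⟩ := Ideal.Quotient.mk_surjective c
    rw [← map_mul, ← map_one (Ideal.Quotient.mk (Ideal.span {a})), Ideal.Quotient.eq,
      Ideal.mem_span_singleton] at hc
    obtain ⟨v, hv⟩ := hc
    refine ⟨u, -v, ?_⟩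
    rw [show p * u + a * -v = 1 by linear_combination hv]
    exact isUnit_one
  · rintro ⟨u, v, h⟩
    have h' := h.map (Ideal.Quotient.mk (Ideal.span {a}))
    have ha : Ideal.Quotient.mk (Ideal.span {a}) a = 0 :=
      Ideal.Quotient.eq_zero_iff_mem.mpr (Ideal.mem_span_singleton_self a)
    rw [map_add, map_mul, map_mul, ha, zero_mul, add_zero] at h'
    exact isUnit_of_mul_isUnit_left h'

theorem span_sup_span_eq_top_iff_exists_isUnit {R : Type*} [CommRing R] (p q : R) :
    Ideal.span {p} ⊔ Ideal.span {q} = ⊤ ↔ ∃ u v : R, IsUnit (p * u + q * v) := by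
  rw [← Ideal.isCoprime_iff_sup_eq, Ideal.isCoprime_span_singleton_iff]
  constructor
  · rintro ⟨u, v, h⟩
    refine ⟨u, v, ?_⟩
    rw [mul_comm p, mul_comm q, h]
    exact isUnit_one
  · rintro ⟨u, v, h⟩
    obtain ⟨c, hc⟩ := isUnit_iff_exists_inv.mp h
    exact ⟨u * c, v * c, by linear_combination hc⟩

theorem stableRange1_quotient_span_singleton_iff {R : Type*} [CommRing R] (a : R) :
    StableRange1 (R ⧸ Ideal.span {a}) ↔
      ∀ p q : R, (∃ u v w z : R, IsUnit ((p * u + q * v) * w + a * z)) →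
        ∃ y u v : R, IsUnit ((p + q * y) * u + a * v) := by
  simp only [StableRange1, span_sup_span_eq_top_iff_exists_isUnit,
    Ideal.Quotient.mk_surjective.forall, Ideal.Quotient.mk_surjective.exists, ← map_mul,
    ← map_add, isUnit_quotient_span_singleton_mk_iff]

theorem mem_jacobson_bot_iff_map {S R : Type*} [CommRing S] [CommRing R] (f : S →+* R)
    (hf : Function.Surjective f) (hu : ∀ x, IsUnit (f x) ↔ IsUnit x) (x : S) :
    f x ∈ Ideal.jacobson (⊥ : Ideal R) ↔ x ∈ Ideal.jacobson (⊥ : Ideal S) := by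
  simp only [Ideal.mem_jacobson_bot, hf.forall, ← map_mul, ← map_add, ← map_one f, hu]

theorem stableRange1_quotient_map_iff {S R : Type*} [CommRing S] [CommRing R] (f : S →+* R)
    (hf : Function.Surjective f) (hu : ∀ x, IsUnit (f x) ↔ IsUnit x) (a : S) :
    StableRange1 (R ⧸ Ideal.span {f a}) ↔ StableRange1 (S ⧸ Ideal.span {a}) := by
  simp only [stableRange1_quotient_span_singleton_iff, hf.forall, hf.exists, ← map_mul,
    ← map_add, hu]

/-- J-stability is invariant under surjections that reflect units. -/
theorem jstable_iff_of_surjective_of_isUnit_map_iff {S R : Type*} [CommRing S] [CommRing R]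
    (f : S →+* R) (hf : Function.Surjective f) (hu : ∀ x, IsUnit (f x) ↔ IsUnit x) :
    JStable S ↔ JStable R := by
  simp only [JStable, hf.forall, mem_jacobson_bot_iff_map f hf hu,
    stableRange1_quotient_map_iff f hf hu]

theorem jstable_iff_trivSqZeroExt (R : Type*) [CommRing R]
    (M : Type*) [AddCommGroup M] [Module R M] [Module Rᵐᵒᵖ M] [IsCentralScalar R M] :
    JStable R ↔ JStable (TrivSqZeroExt R M) := by
  exact (jstable_iff_of_surjective_of_isUnit_map_iff
    (TrivSqZeroExt.fstHom R R M : TrivSqZeroExt R M →+* R)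
    (fun r => ⟨TrivSqZeroExt.inl r, TrivSqZeroExt.fst_inl M r⟩)
    (fun _ => TrivSqZeroExt.isUnit_iff_isUnit_fst.symm)).symm
end

section
/- Let R be a J-adequate ring. Then every prime ideal of R that is not contained in J(R) is contained in a unique maximal ideal of R. -/
/-- An element `a` of a commutative ring is adequate if for every `b` there exist
`r, s` with `a = r * s`, `rR + bR = R`, and `s'R + bR ≠ R` for every non-unit
divisor `s'` of `s`. -/
def Adequate {R : Type*} [CommRing R] (a : R) : Prop :=
  ∀ b : R, ∃ r s : R, a = r * s ∧ Ideal.span {r} ⊔ Ideal.span {b} = ⊤ ∧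
    ∀ s' : R, ¬ IsUnit s' → s' ∣ s → Ideal.span {s'} ⊔ Ideal.span {b} ≠ ⊤

/-- A Bézout ring is J-adequate if every element not in the Jacobson radical
is adequate. -/
def JAdequate (R : Type*) [CommRing R] : Prop :=
  IsBezout R ∧ ∀ a : R, a ∉ Ideal.jacobson (⊥ : Ideal R) → Adequate a

/-- In a Bézout ring, a prime ideal containing an adequate element lies in at most one
maximal ideal. -/
theorem Adequate.eq_of_isMaximal_of_le {R : Type*} [CommRing R] [IsBezout R] {a : R}
    (ha : Adequate a) {P M N : Ideal R} (hP : P.IsPrime) (haP : a ∈ P)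
    (hM : M.IsMaximal) (hN : N.IsMaximal) (hPM : P ≤ M) (hPN : P ≤ N) : M = N := by
  by_contra hne
  have hMN : M ⊔ N = ⊤ := hM.coprime_of_ne hN hne
  obtain ⟨m, hm, n, hn, hmn⟩ := Submodule.mem_sup.1 ((Ideal.eq_top_iff_one _).1 hMN)
  obtain ⟨r, s, hrs, hr, hs⟩ := ha m
  have hrP : r ∉ P := fun hrP => hM.ne_top <| top_le_iff.1 <| hr ▸
    sup_le ((Ideal.span_singleton_le_iff_mem M).2 (hPM hrP))
      ((Ideal.span_singleton_le_iff_mem M).2 hm)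
  have hsP : s ∈ P := (hP.mem_or_mem (hrs ▸ haP)).resolve_left hrP
  obtain ⟨d, hd⟩ := (IsBezout.span_pair_isPrincipal s n).principal
  have hd' : Ideal.span {s, n} = Ideal.span {d} := hd
  have hsd : d ∣ s := Ideal.mem_span_singleton.1 (hd' ▸ Ideal.subset_span (by simp))
  have hnd : n ∈ Ideal.span {d} := hd' ▸ Ideal.subset_span (by simp)
  have hdN : d ∈ N := by
    have hle : Ideal.span {s, n} ≤ N := Ideal.span_le.2 (by
      rintro x (rfl | rfl)
      exacts [hPN hsP, hn])
    exact hle (hd' ▸ Ideal.mem_span_singleton_self d)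
  refine hs d (fun hu => hN.ne_top (Ideal.eq_top_of_isUnit_mem N hdN hu)) hsd ?_
  rw [Ideal.eq_top_iff_one, ← hmn, add_comm m n]
  exact Submodule.add_mem_sup hnd (Ideal.mem_span_singleton_self m)

theorem jAdequate_prime_unique_maximal (R : Type*) [CommRing R]
    (h : JAdequate R) (P : Ideal R) (hP : P.IsPrime)
    (hPJ : ¬ P ≤ Ideal.jacobson (⊥ : Ideal R)) :
    ∃! M : Ideal R, M.IsMaximal ∧ P ≤ M := by
  obtain ⟨hB, hA⟩ := h
  obtain ⟨a, haP, haJ⟩ := SetLike.not_le_iff_exists.1 hPJ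
  obtain ⟨M, hM, hPM⟩ := Ideal.exists_le_maximal P hP.ne_top
  exact ⟨M, ⟨hM, hPM⟩, fun N hN =>
    (hA a haJ).eq_of_isMaximal_of_le hP haP hN.1 hM hN.2 hPM⟩
end

section
/- Let R be a J-stable ring. Then R is a Bézout ring if and only if R is an elementary divisor ring. -/
/-- A matrix `A` admits diagonal reduction if there are invertible matrices `P, Q`
such that `P * A * Q` is diagonal (entries off the main diagonal vanish) and each
diagonal entry divides the next one. -/
def AdmitsDiagonalReduction {R : Type*} [CommRing R] {m n : ℕ}
    (A : Matrix (Fin m) (Fin n) R) : Prop :=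
  ∃ (P : Matrix (Fin m) (Fin m) R) (Q : Matrix (Fin n) (Fin n) R),
    IsUnit P ∧ IsUnit Q ∧
    (∀ (i : Fin m) (j : Fin n), (i : ℕ) ≠ (j : ℕ) → (P * A * Q) i j = 0) ∧
    (∀ (i : Fin m) (j : Fin n) (i' : Fin m) (j' : Fin n),
      (i : ℕ) = (j : ℕ) → (i' : ℕ) = (j' : ℕ) → (i' : ℕ) = (i : ℕ) + 1 →
      (P * A * Q) i j ∣ (P * A * Q) i' j')

/-- A commutative ring is an elementary divisor ring if every matrix over it
admits diagonal reduction. -/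
def ElementaryDivisorRing (R : Type*) [CommRing R] : Prop :=
  ∀ (m n : ℕ) (A : Matrix (Fin m) (Fin n) R), AdmitsDiagonalReduction A

open Matrix

/-- A ring in which every pair has a greatest common divisor with unimodular cofactors
(a Hermite ring in the sense of Kaplansky). -/
def HermiteRing (R : Type*) [CommRing R] : Prop :=
  ∀ a b : R, ∃ d a' b' x y : R, a = d * a' ∧ b = d * b' ∧ a' * x + b' * y = 1

/-- Kaplansky's condition on triangular `2 × 2` matrices with unimodular entries. -/
def KaplanskyCondition (R : Type*) [CommRing R] : Prop :=
  ∀ a b c x y z : R, a * x + b * y + c * z = 1 →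
    ∃ p q u v : R, (p * a + q * b) * u + q * c * v = 1

section

variable {R : Type*} [CommRing R]

/-- The block diagonal matrix with blocks `d` and `B`. -/
def consBlock {m n : ℕ} (d : R) (B : Matrix (Fin m) (Fin n) R) :
    Matrix (Fin (m + 1)) (Fin (n + 1)) R :=
  Matrix.of (Fin.cons (Fin.cons d 0) fun i => Fin.cons 0 (B i))

/-- A `2 × 2` block in the upper left corner, completed by the identity. -/
def cornerBlock (n : ℕ) (a b c d : R) : Matrix (Fin (n + 2)) (Fin (n + 2)) R :=
  Matrix.of (Fin.cons (Fin.cons a (Fin.cons b 0))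
    (Fin.cons (Fin.cons c (Fin.cons d 0))
      fun i => Fin.cons 0 (Fin.cons 0 ((1 : Matrix (Fin n) (Fin n) R) i))))

lemma JStable.exists_mul_add_mul_eq_one (h : JStable R) {a b c x y z : R}
    (hc : c ∉ Ideal.jacobson (⊥ : Ideal R)) (e : a * x + b * y + c * z = 1) :
    ∃ p u v : R, (b + a * p) * u + c * v = 1 := by
  let π := Ideal.Quotient.mk (Ideal.span {c})
  have hπc : π c = 0 := Ideal.Quotient.eq_zero_iff_mem.2 (Ideal.mem_span_singleton_self c)
  obtain ⟨p, hp⟩ := h c hc (π b) (π a) <| by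
    rw [Ideal.eq_top_iff_one, ← Ideal.span_insert, Ideal.mem_span_pair]
    refine ⟨π y, π x, ?_⟩
    have := congrArg π e
    simp only [map_add, map_mul, map_one, hπc] at this
    linear_combination this
  obtain ⟨p, rfl⟩ := Ideal.Quotient.mk_surjective p
  obtain ⟨u, hu⟩ := hp.exists_right_inv
  obtain ⟨u, rfl⟩ := Ideal.Quotient.mk_surjective u
  have : π (1 - (b + a * p) * u) = 0 := by
    simp only [map_sub, map_one, map_mul, map_add]
    exact sub_eq_zero.2 hu.symm
  rw [Ideal.Quotient.eq_zero_iff_mem, Ideal.mem_span_singleton] at this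
  obtain ⟨v, hv⟩ := this
  exact ⟨p, u, v, by linear_combination -hv⟩

lemma isUnit_of_mul_add_mul_eq_one {a b x y : R} (ha : a ∈ Ideal.jacobson (⊥ : Ideal R))
    (e : a * x + b * y = 1) : IsUnit b := by
  have := Ideal.mem_jacobson_bot.1 ha (-x)
  rw [show a * -x + 1 = b * y by linear_combination -e] at this
  exact isUnit_of_mul_isUnit_left this

lemma JStable.kaplanskyCondition (h : JStable R) : KaplanskyCondition R := by
  intro a b c x y z e
  by_cases hc : c ∈ Ideal.jacobson (⊥ : Ideal R)
  · obtain ⟨w, hw⟩ := (isUnit_of_mul_add_mul_eq_one (a := c) (b := a * x + b * y) (x := z)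
      (y := 1) hc (by linear_combination e)).exists_right_inv
    exact ⟨x, y, w, 0, by linear_combination hw⟩
  · obtain ⟨p, u, v, hp⟩ := h.exists_mul_add_mul_eq_one hc e
    exact ⟨p, 1, u, v, by linear_combination hp⟩

/-- A J-stable ring has stable range at most 2. -/
lemma JStable.exists_unimodular_pair (h : JStable R) {a b c x y z : R}
    (e : a * x + b * y + c * z = 1) :
    ∃ p q u v : R, (a + c * p) * u + (b + c * q) * v = 1 := by
  by_cases ha : a ∈ Ideal.jacobson (⊥ : Ideal R)
  · by_cases hb : b ∈ Ideal.jacobson (⊥ : Ideal R)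
    · have hm := Ideal.add_mem _ (Ideal.mul_mem_right x _ ha) (Ideal.mul_mem_right y _ hb)
      obtain ⟨w, hw⟩ := (isUnit_of_mul_add_mul_eq_one (b := c) (x := 1) (y := z) hm
        (by linear_combination e)).exists_right_inv
      exact ⟨w * (1 - a), 0, 1, 0, by linear_combination (1 - a) * hw⟩
    · obtain ⟨p, u, v, hp⟩ := h.exists_mul_add_mul_eq_one (a := c) (b := a) (c := b) (x := z)
        (y := x) (z := y) hb (by linear_combination e)
      exact ⟨p, 0, u, v, by linear_combination hp⟩
  · obtain ⟨p, u, v, hp⟩ := h.exists_mul_add_mul_eq_one (a := c) (b := b) (c := a) (x := z)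
      (y := y) (z := x) ha (by linear_combination e)
    exact ⟨0, p, v, u, by linear_combination hp⟩

lemma JStable.hermiteRing (h : JStable R) [IsBezout R] : HermiteRing R := by
  intro a b
  obtain ⟨a', ha⟩ := IsBezout.gcd_dvd_left a b
  obtain ⟨b', hb⟩ := IsBezout.gcd_dvd_right a b
  obtain ⟨x, y, hxy⟩ := IsBezout.gcd_eq_sum a b
  generalize IsBezout.gcd a b = d at *
  obtain ⟨p, q, u, v, e⟩ := h.exists_unimodular_pair (a := a') (b := b')
    (c := 1 - a' * x - b' * y) (x := x) (y := y) (z := 1) (by ring)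
  have hd : d * (1 - a' * x - b' * y) = 0 := by
    linear_combination -hxy + x * ha + y * hb
  exact ⟨d, _, _, u, v, by linear_combination ha - p * hd, by linear_combination hb - q * hd, e⟩

lemma HermiteRing.exists_eq_smul (H : HermiteRing R) {n : ℕ} (v : Fin (n + 1) → R) :
    ∃ (d : R) (v' u : Fin (n + 1) → R), v = d • v' ∧ v' ⬝ᵥ u = 1 := by
  induction n with
  | zero =>
    refine ⟨v 0, 1, 1, ?_, by simp⟩
    ext i
    rw [Fin.eq_zero i]
    simp
  | succ n ih =>
    obtain ⟨c, w, u, hw, hu⟩ := ih (Fin.tail v)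
    obtain ⟨d, a, b, x, y, ha, hb, e⟩ := H (v 0) c
    refine ⟨d, Fin.cons a (b • w), Fin.cons x (y • u), ?_, ?_⟩
    · ext i
      refine Fin.cases ?_ (fun i => ?_) i
      · simpa using ha
      · have := congrFun hw i
        simp only [Fin.tail, Pi.smul_apply, smul_eq_mul] at this
        simp [this, hb, mul_assoc]
    · have : (Fin.cons a (b • w) : Fin (n + 2) → R) ⬝ᵥ Fin.cons x (y • u)
          = a * x + (b • w) ⬝ᵥ (y • u) := by
        simp [dotProduct, Fin.sum_univ_succ]
      rw [this, smul_dotProduct, dotProduct_smul, hu]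
      simpa using e

lemma exists_unimodular_combination (H : HermiteRing R) (K : KaplanskyCondition R) {n : ℕ}
    (r s x y : Fin (n + 1) → R) (e : r ⬝ᵥ x + s ⬝ᵥ y = 1) :
    ∃ (p q : R) (z : Fin (n + 1) → R), (p • r + q • s) ⬝ᵥ z = 1 := by
  obtain ⟨a, r', f, rfl, hf⟩ := H.exists_eq_smul r
  obtain ⟨c, t, g, ht, hg⟩ := H.exists_eq_smul (s - (s ⬝ᵥ f) • r')
  set b := s ⬝ᵥ f with hb
  have hs : s = b • r' + c • t := by rw [← ht]; abel
  have htf : c * (t ⬝ᵥ f) = 0 := by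
    have := congrArg (· ⬝ᵥ f) hs
    simp only [add_dotProduct, smul_dotProduct, smul_eq_mul, hf, ← hb] at this
    linear_combination -this
  clear_value b
  subst hs
  simp only [add_dotProduct, smul_dotProduct, smul_eq_mul] at e
  obtain ⟨p, q, u, v, h⟩ := K a b c (r' ⬝ᵥ x) (r' ⬝ᵥ y) (t ⬝ᵥ y) (by linear_combination e)
  refine ⟨p, q, u • f + v • (g - (r' ⬝ᵥ g) • f), ?_⟩
  simp only [add_dotProduct, smul_dotProduct, smul_eq_mul, dotProduct_add, dotProduct_smul,
    dotProduct_sub, hf, hg]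
  linear_combination h + (q * u - q * v * (r' ⬝ᵥ g)) * htf

lemma exists_eq_smul_dotProduct_mulVec (H : HermiteRing R) (K : KaplanskyCondition R) {m n : ℕ}
    (A : Matrix (Fin (m + 1)) (Fin (n + 1)) R) :
    ∃ (d : R) (A' : Matrix (Fin (m + 1)) (Fin (n + 1)) R) (p : Fin (m + 1) → R)
      (x : Fin (n + 1) → R), A = d • A' ∧ (p ᵥ* A') ⬝ᵥ x = 1 := by
  induction m with
  | zero =>
    obtain ⟨d, v, u, hv, hu⟩ := H.exists_eq_smul (A 0)
    refine ⟨d, Matrix.of fun _ => v, 1, u, ?_, ?_⟩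
    · ext i j
      rw [Fin.eq_zero i, hv]
      simp
    · rw [← hu]
      congr 1
      ext j
      simp [vecMul, dotProduct]
  | succ m ih =>
    obtain ⟨a, r, x, hr, hx⟩ := H.exists_eq_smul (A 0)
    obtain ⟨c, B, p, y, hB, hy⟩ := ih (Matrix.of fun i => A i.succ)
    obtain ⟨d, a', c', k, l, ha, hc, e⟩ := H a c
    obtain ⟨s, t, z, hz⟩ := exists_unimodular_combination H K (a' • r) (c' • (p ᵥ* B))
      (k • x) (l • y) (by
        simp only [smul_dotProduct, dotProduct_smul, hx, hy, smul_eq_mul]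
        linear_combination e)
    refine ⟨d, Matrix.of (Fin.cons (a' • r) fun i => c' • B i), Fin.cons s (t • p), z, ?_, ?_⟩
    · ext i j
      refine Fin.cases ?_ (fun i => ?_) i
      · simp [hr, ha, mul_assoc]
      · have := congrFun (congrFun hB i) j
        simp only [Matrix.of_apply, Matrix.smul_apply, smul_eq_mul] at this
        simp [this, hc, mul_assoc]
    · rw [← hz]
      congr 1
      ext j
      simp only [vecMul, dotProduct, Fin.sum_univ_succ (n := m + 1), Matrix.of_apply,
        Fin.cons_zero, Fin.cons_succ, Pi.add_apply, Pi.smul_apply, smul_eq_mul, Finset.mul_sum]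
      congr 1
      exact Finset.sum_congr rfl fun i _ => by ring

lemma consBlock_mul {l m n : ℕ} (d e : R) (B : Matrix (Fin l) (Fin m) R)
    (C : Matrix (Fin m) (Fin n) R) :
    consBlock d B * consBlock e C = consBlock (d * e) (B * C) := by
  ext i j
  refine Fin.cases ?_ (fun i => ?_) i <;> refine Fin.cases ?_ (fun j => ?_) j <;>
    simp [consBlock, Matrix.mul_apply, Fin.sum_univ_succ]

lemma consBlock_one (n : ℕ) : consBlock (1 : R) (1 : Matrix (Fin n) (Fin n) R) = 1 := by
  ext i j
  refine Fin.cases ?_ (fun i => ?_) i <;> refine Fin.cases ?_ (fun j => ?_) j <;>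
    simp [consBlock, Matrix.one_apply, Fin.succ_ne_zero, (Fin.succ_ne_zero _).symm]

lemma isUnit_consBlock_one {n : ℕ} {P : Matrix (Fin n) (Fin n) R} (hP : IsUnit P) :
    IsUnit (consBlock 1 P) := by
  obtain ⟨Q, h₁, h₂⟩ := isUnit_iff_exists.1 hP
  refine isUnit_iff_exists.2 ⟨consBlock 1 Q, ?_, ?_⟩
  · rw [consBlock_mul, h₁, one_mul, consBlock_one]
  · rw [consBlock_mul, h₂, one_mul, consBlock_one]

lemma cornerBlock_mul (n : ℕ) (a b c d a' b' c' d' : R) :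
    cornerBlock n a b c d * cornerBlock n a' b' c' d' =
      cornerBlock n (a * a' + b * c') (a * b' + b * d') (c * a' + d * c') (c * b' + d * d') := by
  ext i j
  refine Fin.cases ?_ (fun i => Fin.cases ?_ (fun i => ?_) i) i <;>
    refine Fin.cases ?_ (fun j => Fin.cases ?_ (fun j => ?_) j) j <;>
    simp [cornerBlock, Matrix.mul_apply, Fin.sum_univ_succ, Matrix.one_apply]

lemma cornerBlock_one (n : ℕ) : cornerBlock n (1 : R) 0 0 1 = 1 := by
  ext i j
  refine Fin.cases ?_ (fun i => Fin.cases ?_ (fun i => ?_) i) i <;>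
    refine Fin.cases ?_ (fun j => Fin.cases ?_ (fun j => ?_) j) j <;>
    simp [cornerBlock, Matrix.one_apply, Fin.ext_iff]

lemma isUnit_cornerBlock (n : ℕ) {a b c d : R} (h : a * d - b * c = 1) :
    IsUnit (cornerBlock n a b c d) := by
  refine isUnit_iff_exists.2 ⟨cornerBlock n d (-b) (-c) a, ?_, ?_⟩ <;>
  · rw [cornerBlock_mul, ← cornerBlock_one]
    congr 1
    · linear_combination h
    · ring
    · ring
    · linear_combination h

/-- Unimodular vectors over a Hermite ring are completable. -/
lemma HermiteRing.exists_mulVec_eq_single (H : HermiteRing R) {n : ℕ} (v u : Fin (n + 1) → R)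
    (e : v ⬝ᵥ u = 1) :
    ∃ P : Matrix (Fin (n + 1)) (Fin (n + 1)) R, IsUnit P ∧ P *ᵥ v = Pi.single 0 1 := by
  induction n with
  | zero =>
    have e' : u 0 * v 0 = 1 := by simpa [dotProduct, mul_comm] using e
    refine ⟨Matrix.of fun _ _ => u 0, isUnit_iff_exists.2 ⟨Matrix.of fun _ _ => v 0, ?_, ?_⟩, ?_⟩
    · ext i j
      rw [Fin.eq_zero i, Fin.eq_zero j]
      simp [Matrix.mul_apply, e']
    · ext i j
      rw [Fin.eq_zero i, Fin.eq_zero j]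
      simp [Matrix.mul_apply, mul_comm (v 0), e']
    · ext i
      rw [Fin.eq_zero i]
      simp [mulVec, dotProduct, e']
  | succ n ih =>
    obtain ⟨c, w, g, hw, hg⟩ := H.exists_eq_smul (Fin.tail v)
    obtain ⟨P, hP, hPw⟩ := ih w g hg
    have hv : v = Fin.cons (v 0) (c • w) := by rw [← hw, Fin.cons_self_tail]
    have hP' : consBlock 1 P *ᵥ v = Fin.cons (v 0) (c • Pi.single 0 1) := by
      rw [← hPw, ← mulVec_smul]
      rw [hv]
      ext i
      refine Fin.cases ?_ (fun i => ?_) i <;>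
        simp [consBlock, mulVec, dotProduct, Fin.sum_univ_succ (n := n + 1)]
    obtain ⟨k, hk⟩ : ∃ k, v 0 * u 0 + c * k = 1 := by
      refine ⟨w ⬝ᵥ Fin.tail u, ?_⟩
      rw [← e, ← smul_eq_mul c, ← smul_dotProduct, ← hw]
      simp [dotProduct, Fin.sum_univ_succ (n := n + 1), Fin.tail]
    refine ⟨cornerBlock n (u 0) k (-c) (v 0) * consBlock 1 P,
      (isUnit_cornerBlock n (by linear_combination hk)).mul (isUnit_consBlock_one hP), ?_⟩
    rw [← mulVec_mulVec, hP']
    ext i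
    refine Fin.cases ?_ (fun i => Fin.cases ?_ (fun i => ?_) i) i
    · simp [cornerBlock, mulVec, dotProduct, Fin.sum_univ_succ]
      linear_combination hk
    · simp [cornerBlock, mulVec, dotProduct, Fin.sum_univ_succ]
      ring
    · simp [cornerBlock, mulVec, dotProduct, Fin.sum_univ_succ]

lemma AdmitsDiagonalReduction.of_mul_mul {m n : ℕ} {A : Matrix (Fin m) (Fin n) R}
    {P : Matrix (Fin m) (Fin m) R} {Q : Matrix (Fin n) (Fin n) R} (hP : IsUnit P) (hQ : IsUnit Q)
    (h : AdmitsDiagonalReduction (P * A * Q)) : AdmitsDiagonalReduction A := by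
  obtain ⟨P', Q', hP', hQ', h⟩ := h
  refine ⟨P' * P, Q * Q', hP'.mul hP, hQ.mul hQ', ?_⟩
  rw [show P' * P * A * (Q * Q') = P' * (P * A * Q) * Q' by simp only [Matrix.mul_assoc]]
  exact h

lemma AdmitsDiagonalReduction.smul_consBlock_one {m n : ℕ} {B : Matrix (Fin m) (Fin n) R}
    (h : AdmitsDiagonalReduction B) (d : R) : AdmitsDiagonalReduction (d • consBlock 1 B) := by
  obtain ⟨P, Q, hP, hQ, hdiag, hdvd⟩ := h
  refine ⟨consBlock 1 P, consBlock 1 Q, isUnit_consBlock_one hP, isUnit_consBlock_one hQ, ?_⟩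
  rw [Matrix.mul_smul, Matrix.smul_mul, consBlock_mul, consBlock_mul, one_mul, one_mul]
  generalize P * B * Q = D at *
  constructor
  · intro i j
    refine Fin.cases ?_ (fun i => ?_) i <;> refine Fin.cases ?_ (fun j => ?_) j
    · simp
    · simp [consBlock]
    · simp [consBlock]
    · intro hij
      simp [consBlock, hdiag i j (by simpa using hij)]
  · intro i j i' j'
    refine Fin.cases ?_ (fun i => ?_) i <;> refine Fin.cases ?_ (fun j => ?_) j
    · intros
      simp [consBlock]
    · simp
    · simp
    · refine Fin.cases ?_ (fun i' => ?_) i' <;> refine Fin.cases ?_ (fun j' => ?_) j'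
      · simp
      · simp
      · simp
      · intro h₁ h₂ h₃
        simpa [consBlock] using mul_dvd_mul_left d
          (hdvd i j i' j' (by simpa using h₁) (by simpa using h₂) (by simpa using h₃))

/-- A matrix whose first column is the first standard basis vector can be cleared by column
operations. -/
lemma exists_mul_eq_consBlock_one {m n : ℕ} (A : Matrix (Fin (m + 1)) (Fin (n + 1)) R)
    (h : A *ᵥ Pi.single 0 1 = Pi.single 0 1) :
    ∃ (Q : Matrix (Fin (n + 1)) (Fin (n + 1)) R) (B : Matrix (Fin m) (Fin n) R),
      IsUnit Q ∧ A * Q = consBlock 1 B := by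
  have h₀ : A 0 0 = 1 := by simpa using congrFun h 0
  have h₁ : ∀ i : Fin m, A i.succ 0 = 0 := fun i => by simpa using congrFun h i.succ
  let T (r : Fin n → R) : Matrix (Fin (n + 1)) (Fin (n + 1)) R :=
    Matrix.of (Fin.cons (Fin.cons 1 r) fun i => Fin.cons 0 ((1 : Matrix (Fin n) (Fin n) R) i))
  have hT : ∀ r, T r * T (-r) = 1 := by
    intro r
    rw [← consBlock_one]
    ext i j
    refine Fin.cases ?_ (fun i => ?_) i <;> refine Fin.cases ?_ (fun j => ?_) j <;>
      simp [T, consBlock, Matrix.mul_apply, Fin.sum_univ_succ, Matrix.one_apply]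
  refine ⟨T fun j => -A 0 j.succ, Matrix.of fun i j => A i.succ j.succ,
    isUnit_iff_exists.2 ⟨_, hT _, by simpa using hT (-fun j => -A 0 j.succ)⟩, ?_⟩
  ext i j
  refine Fin.cases ?_ (fun i => ?_) i <;> refine Fin.cases ?_ (fun j => ?_) j <;>
    simp [T, consBlock, Matrix.mul_apply, Fin.sum_univ_succ, Matrix.one_apply, h₀, h₁]

theorem HermiteRing.elementaryDivisorRing (H : HermiteRing R) (K : KaplanskyCondition R) :
    ElementaryDivisorRing R := by
  intro m
  induction m with
  | zero => exact fun n A => ⟨1, 1, isUnit_one, isUnit_one, fun i => i.elim0, fun i => i.elim0⟩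
  | succ m ih =>
    rintro (_ | n) A
    · exact ⟨1, 1, isUnit_one, isUnit_one, fun _ j => j.elim0, fun _ j => j.elim0⟩
    obtain ⟨d, A, p, x, rfl, e⟩ := exists_eq_smul_dotProduct_mulVec H K A
    obtain ⟨S, hS, hSx⟩ := H.exists_mulVec_eq_single x (p ᵥ* A) (by rw [dotProduct_comm, e])
    obtain ⟨P, hP, hPx⟩ := H.exists_mulVec_eq_single (A *ᵥ x) p
      (by rw [dotProduct_comm, dotProduct_mulVec, e])
    obtain ⟨T, hST, hTS⟩ := isUnit_iff_exists.1 hS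
    have hT : IsUnit T := isUnit_iff_exists.2 ⟨S, hTS, hST⟩
    obtain ⟨Q, B, hQ, hB⟩ := exists_mul_eq_consBlock_one (P * A * T) (by
      rw [← hSx, mulVec_mulVec, Matrix.mul_assoc, hTS, Matrix.mul_one, ← mulVec_mulVec, hPx])
    refine .of_mul_mul hP (hT.mul hQ) ?_
    rw [Matrix.mul_smul, Matrix.smul_mul, ← Matrix.mul_assoc, hB]
    exact (ih n B).smul_consBlock_one d

theorem ElementaryDivisorRing.isBezout (h : ElementaryDivisorRing R) : IsBezout R := by
  rw [IsBezout.iff_span_pair_isPrincipal]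
  intro a b
  obtain ⟨P, Q, hP, hQ, hdiag, -⟩ := h 1 2 (Matrix.of fun _ => ![a, b])
  obtain ⟨P', -, hP'⟩ := isUnit_iff_exists.1 hP
  obtain ⟨Q', hQ', -⟩ := isUnit_iff_exists.1 hQ
  set A : Matrix (Fin 1) (Fin 2) R := Matrix.of fun _ => ![a, b] with hA
  set D := P * A * Q with hD
  have hAD : A = P' * D * Q' := by
    rw [hD, show P' * (P * A * Q) * Q' = (P' * P) * A * (Q * Q') by simp only [Matrix.mul_assoc],
      hP', hQ', Matrix.one_mul, Matrix.mul_one]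
  have h01 : D 0 1 = 0 := hdiag 0 1 (by simp)
  have key : ∀ j, A 0 j = D 0 0 * (P' 0 0 * Q' 0 j) := by
    intro j
    rw [hAD]
    simp only [Matrix.mul_apply, Fin.sum_univ_two, Finset.univ_unique, Fin.default_eq_zero,
      Finset.sum_singleton, h01]
    ring
  refine ⟨D 0 0, le_antisymm ?_ ?_⟩
  · rw [Ideal.submodule_span_eq, Ideal.span_le]
    rintro z (rfl | rfl)
    · exact Ideal.mem_span_singleton.2 ⟨_, key 0⟩
    · exact Ideal.mem_span_singleton.2 ⟨_, key 1⟩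
  · rw [Ideal.submodule_span_eq, Ideal.span_singleton_le_iff_mem, Ideal.mem_span_pair]
    refine ⟨P 0 0 * Q 0 0, P 0 0 * Q 1 0, ?_⟩
    simp only [hD, hA, Matrix.mul_apply, Fin.sum_univ_two, Finset.univ_unique,
      Fin.default_eq_zero, Finset.sum_singleton, Matrix.of_apply, Matrix.cons_val_zero,
      Matrix.cons_val_one]
    ring

end

theorem jstable_bezout_iff_edr (R : Type*) [CommRing R] (h : JStable R) :
    IsBezout R ↔ ElementaryDivisorRing R :=
  ⟨fun _ => h.hermiteRing.elementaryDivisorRing h.kaplanskyCondition,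
    ElementaryDivisorRing.isBezout⟩
end
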